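/- Every finite poset that admits an {A,B}-representation and contains no induced copy of the poset H admits a {C,D}-representation and an {A,C}-representation. -/

import Mathlib

/-- The four interval types. -/
inductive IType : Type
  | A
  | B
  | C
  | D
  deriving DecidableEq

/-- `typeComp s t` holds iff `s = B`, or `t = B`, or `s = t = C`, or `s = t = D`. -/
def typeComp : IType → IType → Prop := fun s t =>
  s = IType.B ∨ t = IType.B ∨ (s = IType.C ∧ t = IType.C) ∨ (s = IType.D ∧ t = IType.D)

/-- An `S`-representation of the poset `(X, prec)`: centers `c` and types `τ` with
`τ x ∈ S` for all `x`, such that `prec x y ↔ c x + 1 < c y ∨ (c x + 1 = c y ∧ comp (τ x) (τ y))`. -/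
def SRep {X : Type*} (prec : X → X → Prop) (S : Set IType) (c : X → ℝ) (τ : X → IType) : Prop :=
  (∀ x, τ x ∈ S) ∧
    ∀ x y, prec x y ↔ (c x + 1 < c y ∨ (c x + 1 = c y ∧ typeComp (τ x) (τ y)))

/-- A poset is an `S`-order if it admits an `S`-representation. -/
def SOrder {X : Type*} (prec : X → X → Prop) (S : Set IType) : Prop :=
  ∃ c τ, SRep prec S c τ

/-- Incomparability `x ∥ y`. -/
def Incomp {X : Type*} (prec : X → X → Prop) (x y : X) : Prop :=
  ¬ prec x y ∧ ¬ prec y x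

/-- `x 0, x 1, …, x t` is a forcing trail: each step is an up-step or a side-step. -/
def ForcingTrail {X : Type*} (prec : X → X → Prop) (t : ℕ) (x : ℕ → X) : Prop :=
  ∀ i < t, prec (x i) (x (i + 1)) ∨ Incomp prec (x i) (x (i + 1))

open scoped Classical in
/-- `trailVal prec x i` = number of up-steps minus number of side-steps among the
first `i` steps of the trail `x`. -/
noncomputable def trailVal {X : Type*} (prec : X → X → Prop) (x : ℕ → X) (i : ℕ) : ℤ :=
  ∑ j ∈ Finset.range i, if prec (x j) (x (j + 1)) then 1 else -1

/-- A unit interval order. -/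
def UnitIntervalOrder {X : Type*} (prec : X → X → Prop) : Prop :=
  ∃ f : X → ℝ, ∀ x y, prec x y ↔ f x + 1 < f y

/-- Exchange the types `C` and `D`, fixing `A` and `B`. -/
def swapCD : IType → IType
  | IType.C => IType.D
  | IType.D => IType.C
  | t => t

/-- Two distinct elements are twins if they are incomparable and have the same
comparabilities with every other element. -/
def Twins {X : Type*} (prec : X → X → Prop) (x y : X) : Prop :=
  x ≠ y ∧ Incomp prec x y ∧
    ∀ z, z ≠ x → z ≠ y → ((prec z x ↔ prec z y) ∧ (prec x z ↔ prec y z))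

/-- A poset is twin-free if it contains no twins. -/
def TwinFree {X : Type*} (prec : X → X → Prop) : Prop :=
  ∀ x y, ¬ Twins prec x y

/-- A unit OC interval order: unit intervals with left endpoint `g x`, open iff `o x`. -/
def UnitOCOrder {X : Type*} (prec : X → X → Prop) : Prop :=
  ∃ (g : X → ℝ) (o : X → Bool), ∀ x y,
    prec x y ↔ (g x + 1 < g y ∨ (g x + 1 = g y ∧ (o x = true ∨ o y = true)))

/-- `P` contains an induced copy of `Q`. -/
def ContainsInduced {X : Type*} {Q : Type*} (prec : X → X → Prop) (qrel : Q → Q → Prop) : Prop :=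
  ∃ f : Q → X, Function.Injective f ∧ ∀ a b, qrel a b ↔ prec (f a) (f b)

/-- The poset `2+2`: elements `a = 0, b = 1, p = 2, q = 3`; relations `a ≺ b`, `p ≺ q`. -/
def rel2p2 : Fin 4 → Fin 4 → Prop := fun i j =>
  (i = 0 ∧ j = 1) ∨ (i = 2 ∧ j = 3)

/-- The poset `3+1`: a chain `0 ≺ 1 ≺ 2` plus the isolated element `3`. -/
def rel3p1 : Fin 4 → Fin 4 → Prop := fun i j =>
  (i : ℕ) < (j : ℕ) ∧ (j : ℕ) ≤ 2

/-- The poset `4+1`: a chain `0 ≺ 1 ≺ 2 ≺ 3` plus the isolated element `4`. -/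
def rel4p1 : Fin 5 → Fin 5 → Prop := fun i j =>
  (i : ℕ) < (j : ℕ) ∧ (j : ℕ) ≤ 3

/-- The poset `3+1+1`: a chain `0 ≺ 1 ≺ 2` plus isolated elements `3, 4`. -/
def rel3p1p1 : Fin 5 → Fin 5 → Prop := fun i j =>
  (i : ℕ) < (j : ℕ) ∧ (j : ℕ) ≤ 2

/-- The poset `Z`: `x = 0, y = 1, z = 2, w = 3, u = 4, v = 5` with relations
`x≺y, x≺z, x≺w, y≺z, y≺w, z≺w, x≺v, u≺w`. -/
def relZ : Fin 6 → Fin 6 → Prop := fun i j =>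
  ((i : ℕ) < (j : ℕ) ∧ (j : ℕ) ≤ 3) ∨ (i = 0 ∧ j = 5) ∨ (i = 4 ∧ j = 3)

/-- The poset `D`: `x = 0, y = 1, w = 2, z = 3, v = 4` with relations
`x≺y, x≺w, x≺z, y≺z, w≺z`. -/
def relD : Fin 5 → Fin 5 → Prop := fun i j =>
  (i = 0 ∧ (j = 1 ∨ j = 2 ∨ j = 3)) ∨ ((i = 1 ∨ i = 2) ∧ j = 3)

/-- The poset `Y`: `x = 0, y = 1, z = 2, w = 3, v = 4` with relations
`x≺y, x≺z, x≺w, y≺z, y≺w`. -/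
def relY : Fin 5 → Fin 5 → Prop := fun i j =>
  (i = 0 ∧ (j = 1 ∨ j = 2 ∨ j = 3)) ∨ (i = 1 ∧ (j = 2 ∨ j = 3))

/-- The poset `H`: `x = 0, y = 1, z = 2, w = 3, u = 4, v = 5` with relations
`x≺y, x≺z, x≺w, y≺z, y≺w, z≺w, x≺u, y≺u, v≺z, v≺w`. -/
def relH : Fin 6 → Fin 6 → Prop := fun i j =>
  ((i : ℕ) < (j : ℕ) ∧ (j : ℕ) ≤ 3) ∨ ((i = 0 ∨ i = 1) ∧ j = 4) ∨ (i = 5 ∧ (j = 2 ∨ j = 3))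

/-- The poset `V`: `x = 0, b = 1, c = 2, d = 3, e = 4, f = 5` with relations
`x≺b, x≺c, x≺d, x≺e, b≺d, c≺e`. -/
def relV : Fin 6 → Fin 6 → Prop := fun i j =>
  (i = 0 ∧ (j = 1 ∨ j = 2 ∨ j = 3 ∨ j = 4)) ∨ (i = 1 ∧ j = 3) ∨ (i = 2 ∧ j = 4)

/-- A pair of elements at center distance exactly one, oriented upwards when comparable and
downwards when incomparable. -/
def TightStep {X : Type*} (prec : X → X → Prop) (c : X → ℝ) (x y : X) : Prop :=
  (c x + 1 = c y ∧ prec x y) ∨ (c y + 1 = c x ∧ ¬ prec y x)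

/-- Reachability along tight steps. -/
def TightReach {X : Type*} (prec : X → X → Prop) (c : X → ℝ) : X → X → Prop :=
  Relation.ReflTransGen (TightStep prec c)

/-- A walk whose height changes by one at each step and which goes from above `t` to at most `t`
contains a step from height `t + 1` to height `t`. -/
theorem exists_descent {X : Type*} {r : X → X → Prop} {f : X → ℝ}
    (hr : ∀ p q, r p q → f q = f p + 1 ∨ f q + 1 = f p) {p q : X}
    (h : Relation.ReflTransGen r p q) (t : ℝ) (hq : f q ≤ t) (n : ℕ) (hp : f p = t + 1 + n) :
    ∃ u v, Relation.ReflTransGen r p u ∧ r u v ∧ Relation.ReflTransGen r v q ∧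
      f u = t + 1 ∧ f v = t := by
  induction h using Relation.ReflTransGen.head_induction_on generalizing n with
  | refl => have : (0 : ℝ) ≤ n := n.cast_nonneg; linarith
  | @head a b hab hbq ih =>
    have lift : (∃ m : ℕ, f b = t + 1 + m) → ∃ u v, Relation.ReflTransGen r a u ∧ r u v ∧
        Relation.ReflTransGen r v q ∧ f u = t + 1 ∧ f v = t := by
      rintro ⟨m, hm⟩
      obtain ⟨u, v, h1, h2⟩ := ih m hm
      exact ⟨u, v, h1.head hab, h2⟩
    rcases hr a b hab with h | h
    · exact lift ⟨n + 1, by push_cast; linarith⟩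
    · cases n with
      | zero =>
        simp only [Nat.cast_zero, add_zero] at hp
        exact ⟨a, b, .refl, hab, hbq, hp, by linarith⟩
      | succ k => exact lift ⟨k, by push_cast at hp; linarith⟩

/-- A reflexive transitive relation on a finite type has a real-valued monotone height that is
constant only along symmetric pairs. -/
theorem exists_strict_height {X : Type*} [Finite X] (R : X → X → Prop) (hrefl : ∀ x, R x x)
    (htr : ∀ x y z, R x y → R y z → R x z) :
    ∃ h : X → ℝ, ∀ x y, R x y → h x ≤ h y ∧ (h x = h y → R y x) := by
  refine ⟨fun x => ({z | R z x}.ncard : ℝ), fun x y hxy => ?_⟩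
  have hsub : {z | R z x} ⊆ {z | R z y} := fun z hz => htr _ _ _ hz hxy
  refine ⟨Nat.cast_le.2 (Set.ncard_le_ncard hsub (Set.toFinite _)), fun he => ?_⟩
  have heq := Set.eq_of_subset_of_ncard_le hsub (Nat.cast_le.1 he.ge) (Set.toFinite _)
  have : y ∈ {z | R z y} := hrefl y
  rwa [← heq] at this

/-- A sufficiently small perturbation preserves all strict inequalities `c x + 1 < c y` and
`c y < c x + 1`. -/
theorem exists_small_perturbation {X : Type*} [Finite X] (c h : X → ℝ) :
    ∃ ε : ℝ, 0 < ε ∧ ∀ x y, (c x + 1 < c y → c x + ε * h x + 1 < c y + ε * h y) ∧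
      (c y < c x + 1 → c y + ε * h y < c x + ε * h x + 1) := by
  have hlt : ∀ a b p q : ℝ, a < b → ∀ᶠ ε in nhdsWithin (0 : ℝ) (Set.Ioi 0),
      a + ε * p < b + ε * q := by
    intro a b p q hab
    apply Filter.Eventually.filter_mono nhdsWithin_le_nhds
    have hc1 : ContinuousAt (fun ε : ℝ => a + ε * p) 0 := by fun_prop
    have hc2 : ContinuousAt (fun ε : ℝ => b + ε * q) 0 := by fun_prop
    exact hc1.eventually_lt hc2 (by simpa using hab)
  have hall : ∀ᶠ ε in nhdsWithin (0 : ℝ) (Set.Ioi 0), ∀ x y,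
      (c x + 1 < c y → c x + ε * h x + 1 < c y + ε * h y) ∧
      (c y < c x + 1 → c y + ε * h y < c x + ε * h x + 1) := by
    refine Filter.eventually_all.2 fun x => Filter.eventually_all.2 fun y => ?_
    refine Filter.Eventually.and ?_ ?_
    · by_cases hxy : c x + 1 < c y
      · filter_upwards [hlt _ _ (h x) (h y) hxy] with ε hε _
        linarith
      · exact Filter.Eventually.of_forall fun _ hx => absurd hx hxy
    · by_cases hxy : c y < c x + 1
      · filter_upwards [hlt _ _ (h y) (h x) hxy] with ε hε _
        linarith
      · exact Filter.Eventually.of_forall fun _ hx => absurd hx hxy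
  obtain ⟨ε, hε, hpos⟩ := (hall.and self_mem_nhdsWithin).exists
  exact ⟨ε, hpos, hε⟩

/-- Given weakly feasible centers, types only need to be correct on the tight pairs lying in a
common strongly connected component of the tight-step relation. -/
theorem sOrder_of_tight {X : Type*} [Finite X] {prec : X → X → Prop} {S : Set IType}
    {c : X → ℝ} (hlt : ∀ x y, c x + 1 < c y → prec x y) (hle : ∀ x y, prec x y → c x + 1 ≤ c y)
    (σ : X → IType) (hS : ∀ x, σ x ∈ S)
    (hσ : ∀ x y, c x + 1 = c y → TightReach prec c x y → TightReach prec c y x →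
      (prec x y ↔ typeComp (σ x) (σ y))) :
    SOrder prec S := by
  obtain ⟨h, hh⟩ := exists_strict_height (TightReach prec c) (fun _ => .refl)
    (fun _ _ _ => Relation.ReflTransGen.trans)
  obtain ⟨ε, hε, hpert⟩ := exists_small_perturbation c h
  refine ⟨fun x => c x + ε * h x, σ, hS, fun x y => ?_⟩
  rcases lt_trichotomy (c x + 1) (c y) with hc | hc | hc
  · exact iff_of_true (hlt x y hc) (Or.inl ((hpert x y).1 hc))
  · have hsame : h x = h y → TightReach prec c x y → TightReach prec c y x →
        (prec x y ↔ (c x + ε * h x + 1 < c y + ε * h y ∨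
          (c x + ε * h x + 1 = c y + ε * h y ∧ typeComp (σ x) (σ y)))) := by
      intro he hxy hyx
      have h1 : c x + ε * h x + 1 = c y + ε * h y := by rw [he]; linarith
      rw [hσ x y hc hxy hyx]
      simp [h1]
    by_cases hp : prec x y
    · have hr : TightReach prec c x y := .single (Or.inl ⟨hc, hp⟩)
      obtain ⟨h1, h2⟩ := hh x y hr
      rcases h1.eq_or_lt with he | hl
      · exact hsame he hr (h2 he)
      · have := mul_lt_mul_of_pos_left hl hε
        exact iff_of_true hp (Or.inl (by linarith))
    · have hr : TightReach prec c y x := .single (Or.inr ⟨hc, hp⟩)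
      obtain ⟨h1, h2⟩ := hh y x hr
      rcases h1.eq_or_lt with he | hl
      · exact hsame he.symm (h2 he) hr
      · have := mul_lt_mul_of_pos_left hl hε
        refine iff_of_false hp ?_
        rintro (h' | ⟨h', -⟩) <;> linarith
  · have := (hpert x y).2 hc
    refine iff_of_false (fun hp => absurd (hle x y hp) (by linarith)) ?_
    rintro (h' | ⟨h', -⟩) <;> linarith

section ABRep

variable {X : Type*} {prec : X → X → Prop} {c : X → ℝ} {τ : X → IType}

theorem tightStep_height {x y : X} (h : TightStep prec c x y) :
    c y = c x + 1 ∨ c y + 1 = c x := by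
  rcases h with ⟨h, -⟩ | ⟨h, -⟩
  · exact Or.inl h.symm
  · exact Or.inr h

theorem prec_iff_of_tight (hrep : SRep prec {IType.A, IType.B} c τ) {x y : X}
    (h : c x + 1 = c y) : prec x y ↔ (τ x = IType.B ∨ τ y = IType.B) := by
  have hx := hrep.1 x
  have hy := hrep.1 y
  simp only [Set.mem_insert_iff, Set.mem_singleton_iff] at hx hy
  rw [hrep.2 x y]
  rcases hx with hx | hx <;> rcases hy with hy | hy <;> simp [h, hx, hy, typeComp]

theorem tightStep_up (hrep : SRep prec {IType.A, IType.B} c τ) {x y : X}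
    (h : TightStep prec c x y) (hxy : τ x = IType.B ∨ τ y = IType.B) : c x + 1 = c y := by
  rcases h with h | ⟨h, hn⟩
  · exact h.1
  · exact absurd ((prec_iff_of_tight hrep h).2 hxy.symm) hn

theorem tightStep_down (hrep : SRep prec {IType.A, IType.B} c τ) {x y : X}
    (h : TightStep prec c x y) (hc : c y < c x) : τ x = IType.A ∧ τ y = IType.A := by
  have hn : ¬ (τ x = IType.B ∨ τ y = IType.B) := fun hB => by
    have := tightStep_up hrep h hB
    linarith
  push Not at hn
  have hx := hrep.1 x
  have hy := hrep.1 y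
  simp only [Set.mem_insert_iff, Set.mem_singleton_iff] at hx hy
  tauto

/-- Type-`A` elements on four consecutive levels and type-`B` elements on the two middle levels
induce a copy of `H`. -/
theorem containsInduced_relH (hrep : SRep prec {IType.A, IType.B} c τ) {x y z w u v : X}
    (hx : τ x = IType.A) (hy : τ y = IType.B) (hz : τ z = IType.B) (hw : τ w = IType.A)
    (hu : τ u = IType.A) (hv : τ v = IType.A) (cy : c y = c x + 1) (cz : c z = c x + 2)
    (cw : c w = c x + 3) (cu : c u = c x + 2) (cv : c v = c x + 1) :
    ContainsInduced prec relH := by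
  let F : Fin 6 → X := ![x, y, z, w, u, v]
  let k : Fin 6 → ℕ := ![0, 1, 2, 3, 2, 1]
  let T : Fin 6 → IType := ![.A, .B, .B, .A, .A, .A]
  have hc : ∀ i, c (F i) = c x + k i := by
    intro i; fin_cases i <;> simp [F, k, cy, cz, cw, cu, cv]
  have hT : ∀ i, τ (F i) = T i := by
    intro i; fin_cases i <;> simp [F, T, hx, hy, hz, hw, hu, hv]
  refine ⟨F, fun i j hij => ?_, fun i j => ?_⟩
  · have h1 : k i = k j := by
      have := hc i
      rw [hij, hc j] at this
      exact_mod_cast (add_left_cancel this).symm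
    have h2 : T i = T j := by rw [← hT i, ← hT j, hij]
    have hinj : ∀ i j, k i = k j → T i = T j → i = j := by decide
    exact hinj i j h1 h2
  · rw [hrep.2, hT, hT, hc, hc]
    have e1 : c x + k i + 1 < c x + k j ↔ k i + 1 < k j := by
      rw [add_assoc, add_lt_add_iff_left]; exact_mod_cast Iff.rfl
    have e2 : c x + k i + 1 = c x + k j ↔ k i + 1 = k j := by
      rw [add_assoc, add_right_inj]; exact_mod_cast Iff.rfl
    rw [e1, e2]
    clear e1 e2
    revert i j
    unfold relH typeComp
    decide

/-- Without `H`, a strongly connected component of the tight-step relation has no type-`B`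
elements on two consecutive levels. -/
theorem not_consecutive_B (hrep : SRep prec {IType.A, IType.B} c τ)
    (hH : ¬ ContainsInduced prec relH) {b b' : X} (hb : τ b = IType.B) (hb' : τ b' = IType.B)
    (hc : c b + 1 = c b') (h1 : TightReach prec c b b') (h2 : TightReach prec c b' b) :
    False := by
  have hne : b ≠ b' := by rintro rfl; linarith
  obtain ⟨a, ha, hab⟩ := (Relation.ReflTransGen.cases_head h2).resolve_left hne.symm
  obtain ⟨d, hbd, hd⟩ := (Relation.ReflTransGen.cases_tail h2).resolve_left hne
  have ca := tightStep_up hrep ha (Or.inl hb')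
  have cd := tightStep_up hrep hd (Or.inr hb)
  have had : TightReach prec c a d := (hab.trans h1).trans hbd
  have desc := exists_descent (fun p q h => tightStep_height (c := c) h) had
  obtain ⟨u₁, v₁, -, s₁, -, cu₁, cv₁⟩ := desc (c b + 1) (by linarith) 0 (by push_cast; linarith)
  obtain ⟨u₂, v₂, -, s₂, -, cu₂, cv₂⟩ := desc (c b) (by linarith) 1 (by push_cast; linarith)
  obtain ⟨u₃, v₃, -, s₃, -, cu₃, cv₃⟩ := desc (c b - 1) (by linarith) 2 (by push_cast; linarith)
  have t₁ := tightStep_down hrep s₁ (by linarith)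
  have t₂ := tightStep_down hrep s₂ (by linarith)
  have t₃ := tightStep_down hrep s₃ (by linarith)
  exact hH (containsInduced_relH hrep t₃.2 hb hb' t₁.1 t₂.1 t₂.2
    (by linarith) (by linarith) (by linarith) (by linarith) (by linarith))

/-- Some type-`B` element lies on the level of `x` in the strongly connected component of `x`. -/
def LevelHasB (prec : X → X → Prop) (c : X → ℝ) (τ : X → IType) (x : X) : Prop :=
  ∃ b, τ b = IType.B ∧ c b = c x ∧ TightReach prec c b x ∧ TightReach prec c x b

theorem not_levelHasB_consecutive (hrep : SRep prec {IType.A, IType.B} c τ)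
    (hH : ¬ ContainsInduced prec relH) {x y : X} (hc : c x + 1 = c y)
    (h1 : TightReach prec c x y) (h2 : TightReach prec c y x) :
    ¬ (LevelHasB prec c τ x ∧ LevelHasB prec c τ y) := by
  rintro ⟨⟨b, hb, cb, hbx, hxb⟩, ⟨b', hb', cb', hby, hyb⟩⟩
  exact not_consecutive_B hrep hH hb hb' (by linarith) ((hbx.trans h1).trans hyb)
    ((hby.trans h2).trans hxb)

theorem levelHasB_or (hrep : SRep prec {IType.A, IType.B} c τ) {x y : X} (hc : c x + 1 = c y)
    (h1 : TightReach prec c x y) (h2 : TightReach prec c y x) :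
    LevelHasB prec c τ x ∨ LevelHasB prec c τ y := by
  obtain ⟨u, v, hxu, huv, hvy, cu, cv⟩ := exists_descent (f := fun z => - c z)
    (fun p q h => (tightStep_height (c := c) h).symm.imp (fun h => by linarith)
      (fun h => by linarith)) h1 (- c y) le_rfl 0 (by push_cast; linarith)
  have hcuv : c u + 1 = c v := by linarith
  have hp : prec u v := by
    rcases huv with h | ⟨h, -⟩
    · exact h.2
    · linarith
  rcases (prec_iff_of_tight hrep hcuv).1 hp with hB | hB
  · exact Or.inl ⟨u, hB, by linarith, ((Relation.ReflTransGen.single huv).trans hvy).trans h2, hxu⟩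
  · exact Or.inr ⟨v, hB, by linarith, hvy, (h2.trans hxu).trans (.single huv)⟩

open scoped Classical in
/-- Recolor an `{A,B}`-representation: type-`A` elements on a level with a type-`B` element get
the type `e`, all others get the type `C`. -/
noncomputable def recolor (prec : X → X → Prop) (c : X → ℝ) (τ : X → IType) (e : IType) (x : X) :
    IType :=
  if τ x ≠ IType.B ∧ LevelHasB prec c τ x then e else IType.C

theorem sOrder_recolor [Finite X] (hrep : SRep prec {IType.A, IType.B} c τ)
    (hH : ¬ ContainsInduced prec relH) {e : IType} (heB : e ≠ IType.B) (heC : e ≠ IType.C) :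
    SOrder prec {e, IType.C} := by
  refine sOrder_of_tight (c := c) (fun x y h => (hrep.2 x y).2 (Or.inl h)) (fun x y h => ?_)
    (recolor prec c τ e) (fun x => ?_) (fun x y hc h1 h2 => ?_)
  · rcases (hrep.2 x y).1 h with h | h
    · exact h.le
    · exact h.1.le
  · unfold recolor
    split_ifs <;> simp
  · rw [prec_iff_of_tight hrep hc]
    have hnot := not_levelHasB_consecutive hrep hH hc h1 h2
    have hor := levelHasB_or hrep hc h1 h2
    have self : ∀ z, τ z = IType.B → LevelHasB prec c τ z := fun z hz =>
      ⟨z, hz, rfl, .refl, .refl⟩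
    have hx := self x
    have hy := self y
    by_cases bx : τ x = IType.B <;> by_cases lx : LevelHasB prec c τ x <;>
      by_cases bY : τ y = IType.B <;> by_cases ly : LevelHasB prec c τ y <;>
      simp_all [recolor, typeComp]

end ABRep

/-- a finite `{A,B}`-order with no induced `H` is a `{C,D}`-order and an
`{A,C}`-order. -/
theorem stmt_12 {X : Type*} [Finite X] (prec : X → X → Prop)
    (hirr : ∀ x, ¬ prec x x)
    (htrans : ∀ x y z, prec x y → prec y z → prec x z)
    (hAB : SOrder prec {IType.A, IType.B})
    (hH : ¬ ContainsInduced prec relH) :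
    SOrder prec {IType.C, IType.D} ∧ SOrder prec {IType.A, IType.C} := by
  obtain ⟨c, τ, hrep⟩ := hAB
  refine ⟨?_, sOrder_recolor hrep hH (by decide) (by decide)⟩
  rw [Set.pair_comm]
  exact sOrder_recolor hrep hH (by decide) (by decide)
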